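/- For every n ≥ 2, the axiom system CB_n is sound and complete with respect to the class of all KD45_n models: a formula of L_C is derivable in CB_n if and only if it is satisfied at every state of every KD45 model for n agents. -/

import Mathlib

/-- Formulas of the language `L_C`: atoms, negation, conjunction, common belief `C`. -/
inductive Formula : Type where
  | atom : ℕ → Formula
  | neg  : Formula → Formula
  | and  : Formula → Formula → Formula
  | box  : Formula → Formula

namespace Formula

/-- Implication `φ → ψ` as a derived connective. -/
def imp (φ ψ : Formula) : Formula := neg (and φ (neg ψ))

/-- Disjunction `φ ∨ ψ` as a derived connective. -/
def or (φ ψ : Formula) : Formula := neg (and (neg φ) (neg ψ))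

/-- The diamond `Ĉφ = ¬C¬φ`. -/
def dia (φ : Formula) : Formula := neg (box (neg φ))

/-- A fixed contradiction (used as the empty disjunction). -/
def bot : Formula := and (atom 0) (neg (atom 0))

/-- A fixed tautology (used as the empty conjunction). -/
def top : Formula := neg bot

end Formula

/-- Finite disjunction of a list of formulas. -/
def bigOr (l : List Formula) : Formula := l.foldr Formula.or Formula.bot

/-- Finite conjunction of a list of formulas. -/
def bigAnd (l : List Formula) : Formula := l.foldr Formula.and Formula.top

/-- The list of pairs `(i, j)` with `i < j` in `Fin m`. -/
def pairs (m : ℕ) : List (Fin m × Fin m) :=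
  ((List.finRange m).product (List.finRange m)).filter (fun p => decide (p.1 < p.2))

/-- A Kripke model for `n` agents. -/
structure Model (n : ℕ) where
  W : Type
  nonempty : Nonempty W
  R : Fin n → W → W → Prop
  V : ℕ → W → Prop

/-- `R*`: the transitive closure of the union of the agents' relations. -/
def Model.star {n : ℕ} (M : Model n) : M.W → M.W → Prop :=
  Relation.TransGen (fun x y => ∃ i, M.R i x y)

/-- Satisfaction: `C` quantifies over `R*`-successors. -/
def Sat {n : ℕ} (M : Model n) : M.W → Formula → Prop
  | s, .atom p => M.V p s
  | s, .neg φ => ¬ Sat M s φ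
  | s, .and φ ψ => Sat M s φ ∧ Sat M s ψ
  | s, .box φ => ∀ t, M.star s t → Sat M t φ

/-- A relation is serial if every point has a successor. -/
def Serial {W : Type} (R : W → W → Prop) : Prop := ∀ x, ∃ y, R x y

/-- A relation is Euclidean if `R x y` and `R x z` imply `R y z`. -/
def Euclidean {W : Type} (R : W → W → Prop) : Prop := ∀ x y z, R x y → R x z → R y z

/-- A KD45 model: all agents' relations are serial, transitive and Euclidean. -/
def KD45 {n : ℕ} (M : Model n) : Prop :=
  ∀ i, Serial (M.R i) ∧ Transitive (M.R i) ∧ Euclidean (M.R i)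

/-- `φ` is an instance of a propositional tautology: it is true under every
assignment of truth values to formulas that respects negation and conjunction. -/
def Tautology (φ : Formula) : Prop :=
  ∀ v : Formula → Prop,
    (∀ ψ, v ψ.neg ↔ ¬ v ψ) →
    (∀ ψ χ, v (ψ.and χ) ↔ (v ψ ∧ v χ)) →
    v φ

/-- The axiom `Cn`: `(C ⋀_{i<j}(Cφᵢ ∨ Cφⱼ)) → ⋁_i Cφᵢ`, for `n+1` formulas. -/
def CnAx (n : ℕ) (φ : Fin (n + 1) → Formula) : Formula :=
  ((bigAnd ((pairs (n + 1)).map (fun p => Formula.or ((φ p.1).box) ((φ p.2).box)))).box).imp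
    (bigOr ((List.finRange (n + 1)).map (fun i => (φ i).box)))

/-- The axiom `Ĉn`: `(⋀_i Ĉφᵢ) → Ĉ(⋁_{i<j}(Ĉφᵢ ∧ Ĉφⱼ))`, for `n+1` formulas. -/
def CHatNAx (n : ℕ) (φ : Fin (n + 1) → Formula) : Formula :=
  (bigAnd ((List.finRange (n + 1)).map (fun i => (φ i).dia))).imp
    ((bigOr ((pairs (n + 1)).map (fun p => ((φ p.1).dia).and ((φ p.2).dia)))).dia)

/-- The Hilbert system `CB_n`: Prop, K, D, 4, Cc, Cn, with modus ponens and necessitation. -/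
inductive CB (n : ℕ) : Formula → Prop
  | taut {φ : Formula} : Tautology φ → CB n φ
  | K (φ ψ : Formula) : CB n (((φ.imp ψ).box).imp ((φ.box).imp (ψ.box)))
  | D (φ : Formula) : CB n ((φ.box).imp (((φ.neg).box).neg))
  | four (φ : Formula) : CB n ((φ.box).imp ((φ.box).box))
  | Cc (φ : Formula) : CB n (((φ.box).imp φ).box)
  | Cn (φ : Fin (n + 1) → Formula) : CB n (CnAx n φ)
  | mp {φ ψ : Formula} : CB n (φ.imp ψ) → CB n φ → CB n ψ
  | nec {φ : Formula} : CB n φ → CB n (φ.box)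

/-- A truth assignment to formulas that respects negation and conjunction. -/
structure IsBoolean (v : Formula → Prop) : Prop where
  neg : ∀ φ, v φ.neg ↔ ¬ v φ
  and : ∀ φ ψ, v (φ.and ψ) ↔ (v φ ∧ v ψ)

namespace IsBoolean

variable {v : Formula → Prop}

theorem imp (h : IsBoolean v) (φ ψ : Formula) : v (φ.imp ψ) ↔ (v φ → v ψ) := by
  simp only [Formula.imp, h.neg, h.and]
  tauto

theorem or (h : IsBoolean v) (φ ψ : Formula) : v (φ.or ψ) ↔ (v φ ∨ v ψ) := by
  simp only [Formula.or, h.neg, h.and]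
  tauto

theorem not_bot (h : IsBoolean v) : ¬ v Formula.bot := by
  simp only [Formula.bot, h.neg, h.and]
  tauto

theorem bigOr (h : IsBoolean v) (l : List Formula) : v (bigOr l) ↔ ∃ φ ∈ l, v φ := by
  induction l with
  | nil => simpa [_root_.bigOr] using h.not_bot
  | cons φ l ih =>
    have : v (_root_.bigOr (φ :: l)) ↔ v φ ∨ v (_root_.bigOr l) := h.or _ _
    simp [this, ih]

theorem bigAnd (h : IsBoolean v) (l : List Formula) : v (bigAnd l) ↔ ∀ φ ∈ l, v φ := by
  induction l with
  | nil => simpa [_root_.bigAnd, Formula.top, h.neg] using h.not_bot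
  | cons φ l ih =>
    have : v (_root_.bigAnd (φ :: l)) ↔ v φ ∧ v (_root_.bigAnd l) := h.and _ _
    simp [this, ih]

end IsBoolean

theorem mem_pairs {m : ℕ} (i j : Fin m) : (i, j) ∈ pairs m ↔ i < j := by
  simp [pairs, List.pair_mem_product]

theorem isBoolean_sat {n : ℕ} (M : Model n) (s : M.W) : IsBoolean (Sat M s) :=
  ⟨fun _ => by simp [Sat], fun _ _ => by simp [Sat]⟩

namespace CB

variable {n : ℕ}

theorem of_boolean {φ : Formula} (h : ∀ v, IsBoolean v → v φ) : CB n φ :=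
  taut fun v hn ha => h v ⟨hn, ha⟩

/-- Every point reached by a step of an agent with a Euclidean relation sees itself. -/
theorem star_self_of_star {M : Model n} (hM : KD45 M) {s t : M.W} (h : M.star s t) :
    M.star t t := by
  obtain ⟨u, -, i, hi⟩ := (Relation.TransGen.tail'_iff).1 h
  exact .single ⟨i, (hM i).2.2 _ _ _ hi hi⟩

theorem sat_CnAx {M : Model n} (hM : KD45 M) (s : M.W) (φ : Fin (n + 1) → Formula) :
    Sat M s (CnAx n φ) := by
  rw [CnAx, (isBoolean_sat M s).imp, (isBoolean_sat M s).bigOr]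
  intro h
  by_contra! hc
  have hex : ∀ i, ∃ a x t, M.R a s x ∧
      Relation.ReflTransGen (fun x y => ∃ i, M.R i x y) x t ∧ ¬ Sat M t (φ i) := by
    intro i
    have := hc (φ i).box (List.mem_map.2 ⟨i, List.mem_finRange i, rfl⟩)
    simp only [Sat, not_forall] at this
    obtain ⟨t, hst, ht⟩ := this
    obtain ⟨x, ⟨a, ha⟩, hx⟩ := (Relation.TransGen.head'_iff).1 hst
    exact ⟨a, x, t, ha, hx, ht⟩
  choose a x t hax hxt ht using hex
  have key : ∀ i j, i < j → a i ≠ a j := by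
    intro i j hij he
    have hx := h (x i) (.single ⟨_, hax i⟩)
    rw [(isBoolean_sat M _).bigAnd] at hx
    have := hx _ (List.mem_map.2 ⟨(i, j), (mem_pairs i j).2 hij, rfl⟩)
    rw [(isBoolean_sat M _).or] at this
    rcases this with h1 | h1
    · exact ht i (h1 _ (.head' ⟨a i, (hM _).2.2 _ _ _ (hax i) (hax i)⟩ (hxt i)))
    · refine ht j (h1 _ (.head' ⟨a i, (hM _).2.2 _ _ _ (hax i) ?_⟩ (hxt j)))
      rw [he]
      exact hax j
  obtain ⟨i, j, hij, he⟩ := Fintype.exists_ne_map_eq_of_card_lt a (by simp)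
  rcases lt_or_gt_of_ne hij with h1 | h1
  · exact key i j h1 he
  · exact key j i h1 he.symm

theorem sound {φ : Formula} (h : CB n φ) (hn : 0 < n) {M : Model n} (hM : KD45 M) (s : M.W) :
    Sat M s φ := by
  induction h generalizing s with
  | taut h => exact h _ (isBoolean_sat M s).neg (isBoolean_sat M s).and
  | K φ ψ =>
    simp only [(isBoolean_sat M _).imp, Sat]
    exact fun h1 h2 t ht => h1 t ht (h2 t ht)
  | D φ =>
    simp only [(isBoolean_sat M _).imp, Sat]
    intro h1 h2
    obtain ⟨t, ht⟩ := (hM ⟨0, hn⟩).1 s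
    exact h2 t (.single ⟨_, ht⟩) (h1 t (.single ⟨_, ht⟩))
  | four φ =>
    simp only [(isBoolean_sat M _).imp, Sat]
    exact fun h1 t ht u hu => h1 u (ht.trans hu)
  | Cc φ =>
    simp only [(isBoolean_sat M _).imp, Sat]
    exact fun t ht h1 => h1 t (star_self_of_star hM ht)
  | Cn φ => exact sat_CnAx hM s φ
  | mp _ _ h1 h2 => exact ((isBoolean_sat M s).imp _ _).1 (h1 s) (h2 s)
  | nec _ h1 => exact fun t _ => h1 t

end CB

/-- A set of formulas containing the theorems of `CB n` and closed under modus ponens. -/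
structure IsTheory (n : ℕ) (T : Set Formula) : Prop where
  thm : ∀ {φ}, CB n φ → φ ∈ T
  mp : ∀ {φ ψ : Formula}, φ.imp ψ ∈ T → φ ∈ T → ψ ∈ T

/-- A maximal consistent set of `CB n`. -/
structure MaxCons (n : ℕ) where
  carrier : Set Formula
  isBoolean : IsBoolean (· ∈ carrier)
  isTheory : IsTheory n carrier

namespace MaxCons

variable {n : ℕ}

instance : Membership Formula (MaxCons n) := ⟨fun s φ => φ ∈ s.carrier⟩

theorem boolean (s : MaxCons n) : IsBoolean (· ∈ s) := s.isBoolean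

theorem theory (s : MaxCons n) : IsTheory n {φ | φ ∈ s} := s.isTheory

/-- Lindenbaum's lemma. -/
theorem exists_extension {T : Set Formula} (hT : IsTheory n T) {φ : Formula} (hφ : φ ∉ T) :
    ∃ s : MaxCons n, (∀ ψ ∈ T, ψ ∈ s) ∧ φ ∉ s := by
  obtain ⟨U, hTU, hU⟩ := zorn_subset_nonempty {U | IsTheory n U ∧ φ ∉ U} (by
    intro c hc hchain ⟨V, hV⟩
    refine ⟨⋃₀ c, ⟨⟨fun h => ⟨V, hV, (hc hV).1.thm h⟩, ?_⟩, ?_⟩,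
      fun s hs => Set.subset_sUnion_of_mem hs⟩
    · rintro ψ χ ⟨A, hA, h1⟩ ⟨B, hB, h2⟩
      rcases hchain.total hA hB with h | h
      · exact ⟨B, hB, (hc hB).1.mp (h h1) h2⟩
      · exact ⟨A, hA, (hc hA).1.mp h1 (h h2)⟩
    · rintro ⟨A, hA, h⟩
      exact (hc hA).2 h) T ⟨hT, hφ⟩
  obtain ⟨hUt, hUφ⟩ := hU.prop
  have hmp1 : ∀ {ψ χ : Formula}, (∀ v, IsBoolean v → v ψ → v χ) → ψ ∈ U → χ ∈ U :=
    fun h h1 => hUt.mp (hUt.thm (CB.of_boolean fun v hv => (hv.imp _ _).2 (h v hv))) h1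
  have hmp2 : ∀ {ψ χ θ : Formula}, (∀ v, IsBoolean v → v ψ → v χ → v θ) → ψ ∈ U → χ ∈ U → θ ∈ U :=
    fun h h1 h2 => hUt.mp (hmp1 (fun v hv a => (hv.imp _ _).2 (h v hv a)) h1) h2
  have himp : ∀ ψ, ψ ∉ U → ψ.imp φ ∈ U := by
    intro ψ hψ
    by_contra hno
    have hV : IsTheory n {χ | ψ.imp χ ∈ U} := by
      refine ⟨fun {χ} h => ?_, fun {χ θ} h1 h2 => ?_⟩
      · exact hmp1 (fun v hv a => (hv.imp _ _).2 fun _ => a) (hUt.thm h)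
      · refine hmp2 (fun v hv a b => ?_) h1 h2
        simp only [hv.imp] at *
        tauto
    refine hψ (hU.le_of_ge ⟨hV, hno⟩ ?_ ?_)
    · intro χ h
      exact hmp1 (fun v hv a => (hv.imp _ _).2 fun _ => a) h
    · exact hUt.thm (CB.of_boolean fun v hv => (hv.imp _ _).2 id)
  refine ⟨⟨U, ⟨fun ψ => ⟨fun h1 h2 => ?_, fun h => ?_⟩, fun ψ χ => ⟨fun h => ⟨?_, ?_⟩, fun h => ?_⟩⟩,
    hUt⟩, hTU, hUφ⟩
  · exact hUφ (hmp2 (fun v hv a b => absurd b ((hv.neg _).1 a)) h1 h2)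
  · by_contra h'
    refine hUφ (hmp2 (fun v hv a b => ?_) (himp _ h) (himp _ h'))
    simp only [hv.imp, hv.neg] at *
    tauto
  · exact hmp1 (fun v hv a => ((hv.and _ _).1 a).1) h
  · exact hmp1 (fun v hv a => ((hv.and _ _).1 a).2) h
  · exact hmp2 (fun v hv a b => (hv.and _ _).2 ⟨a, b⟩) h.1 h.2

/-- The canonical accessibility relation. -/
def Rel (s t : MaxCons n) : Prop := ∀ φ : Formula, φ.box ∈ s → φ ∈ t

theorem mem_of_imp (s : MaxCons n) {φ ψ : Formula} (h : CB n (φ.imp ψ)) (hφ : φ ∈ s) : ψ ∈ s :=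
  s.theory.mp (s.theory.thm h) hφ

theorem box_mem_iff (s : MaxCons n) (φ : Formula) : φ.box ∈ s ↔ ∀ t, Rel s t → φ ∈ t := by
  refine ⟨fun h t ht => ht φ h, fun h => ?_⟩
  by_contra hφ
  have hT : IsTheory n {ψ | ψ.box ∈ s} :=
    ⟨fun h => s.theory.thm (.nec h), fun h1 h2 => s.theory.mp (s.mem_of_imp (.K _ _) h1) h2⟩
  obtain ⟨t, ht, hφt⟩ := exists_extension hT hφ
  exact hφt (h t ht)

theorem Rel.trans {s t u : MaxCons n} (h1 : Rel s t) (h2 : Rel t u) : Rel s u :=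
  fun φ h => h2 _ (h1 _ (s.mem_of_imp (.four φ) h))

theorem Rel.self {s t : MaxCons n} (h : Rel s t) : Rel t t :=
  fun φ => (t.boolean.imp _ _).1 (h _ (s.theory.thm (.Cc φ)))

theorem exists_rel (s : MaxCons n) : ∃ t, Rel s t := by
  by_contra! hno
  have h1 : ∀ φ : Formula, φ.box ∈ s := fun φ => (s.box_mem_iff φ).2 fun t ht => absurd ht (hno t)
  exact (s.boolean.neg _).1 (s.mem_of_imp (.D Formula.bot) (h1 _)) (h1 _)

/-- A nonempty chain of successors of `s` has a lower bound among the successors of `s`. -/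
theorem exists_lower_bound (s : MaxCons n) {c : Set (MaxCons n)} (hs : ∀ a ∈ c, Rel s a)
    (hc : ∀ a ∈ c, ∀ b ∈ c, Rel a b ∨ Rel b a) (hne : c.Nonempty) :
    ∃ u, Rel s u ∧ ∀ a ∈ c, Rel u a := by
  have hT : IsTheory n {φ | ∃ a ∈ c, ∀ b ∈ c, Rel b a → φ ∈ b} := by
    constructor
    · intro φ h
      obtain ⟨a, ha⟩ := hne
      exact ⟨a, ha, fun b _ _ => b.theory.thm h⟩
    · rintro φ ψ ⟨a, ha, h1⟩ ⟨a', ha', h2⟩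
      rcases hc a ha a' ha' with h | h
      · exact ⟨a, ha, fun b hb hba => b.theory.mp (h1 b hb hba) (h2 b hb (hba.trans h))⟩
      · exact ⟨a', ha', fun b hb hba => b.theory.mp (h1 b hb (hba.trans h)) (h2 b hb hba)⟩
  obtain ⟨u, hu, -⟩ := exists_extension hT (φ := Formula.bot) (by
    rintro ⟨a, ha, h⟩
    exact a.boolean.not_bot (h a ha (hs a ha).self))
  refine ⟨u, fun φ h => ?_, fun a ha φ h => ?_⟩
  · obtain ⟨a, ha⟩ := hne
    exact hu _ ⟨a, ha, fun b hb _ => hs b hb _ h⟩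
  · by_contra hφ
    refine (u.boolean.neg φ.box).1 (hu _ ⟨a, ha, fun b hb hba => ?_⟩) h
    exact (b.boolean.neg _).2 fun h' => hφ (hba _ h')

/-- `m` is minimal, up to mutual accessibility, among the successors of `s`. -/
def IsMinSucc (s m : MaxCons n) : Prop := Rel s m ∧ ∀ u, Rel s u → Rel u m → Rel m u

theorem exists_isMinSucc (s : MaxCons n) {t : MaxCons n} (ht : Rel s t) :
    ∃ m, IsMinSucc s m ∧ Rel m t := by
  have : Nonempty {u // Rel s u ∧ Rel u t} := ⟨⟨t, ht, ht.self⟩⟩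
  obtain ⟨m, hm⟩ := exists_maximal_of_nonempty_chains_bounded
    (α := {u // Rel s u ∧ Rel u t}) (r := fun a b => Rel b.1 a.1) (by
      intro c hc hne
      obtain ⟨u, hsu, hu⟩ := s.exists_lower_bound (c := Subtype.val '' c)
        (by rintro _ ⟨a, -, rfl⟩; exact a.2.1)
        (by
          rintro _ ⟨a, ha, rfl⟩ _ ⟨b, hb, rfl⟩
          by_cases hab : a = b
          · subst hab
            exact .inl a.2.1.self
          · exact (hc ha hb hab).symm)
        (hne.image _)
      obtain ⟨a, ha⟩ := hne
      exact ⟨⟨u, hsu, (hu a ⟨a, ha, rfl⟩).trans a.2.2⟩, fun b hb => hu b ⟨b, hb, rfl⟩⟩)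
    (fun h1 h2 => h2.trans h1)
  exact ⟨m.1, ⟨m.2.1, fun u hu hum => hm ⟨u, hu, hum.trans m.2.2⟩ hum⟩, m.2.2⟩

/-- Either some successor of `s` sees both `t` and `t'`, or two formulas witness that none does. -/
theorem exists_common_or_separated {s t t' : MaxCons n} :
    (∃ u, Rel s u ∧ Rel u t ∧ Rel u t') ∨
      ∃ ψ ψ', ψ ∉ t ∧ ψ' ∉ t' ∧ ∀ u, Rel s u → ψ.box ∈ u ∨ ψ'.box ∈ u := by
  by_cases hbot : ∃ ψ ψ', ψ ∉ t ∧ ψ' ∉ t' ∧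
      ∀ u, Rel s u → ψ.box ∈ u ∨ ψ'.box ∈ u ∨ Formula.bot ∈ u
  · obtain ⟨ψ, ψ', h1, h2, h⟩ := hbot
    exact .inr ⟨ψ, ψ', h1, h2, fun u hu => by have := u.boolean.not_bot; have := h u hu; tauto⟩
  left
  have hT : IsTheory n {φ | ∃ ψ ψ', ψ ∉ t ∧ ψ' ∉ t' ∧
      ∀ u, Rel s u → ψ.box ∈ u ∨ ψ'.box ∈ u ∨ φ ∈ u} := by
    constructor
    · intro φ h
      exact ⟨_, _, t.boolean.not_bot, t'.boolean.not_bot, fun u _ => .inr (.inr (u.theory.thm h))⟩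
    · rintro φ χ ⟨ψ₁, ψ₁', h1, h1', h⟩ ⟨ψ₂, ψ₂', h2, h2', k⟩
      refine ⟨ψ₁.or ψ₂, ψ₁'.or ψ₂', ?_, ?_, fun u hu => ?_⟩
      · exact fun hm => ((t.boolean.or _ _).1 hm).elim h1 h2
      · exact fun hm => ((t'.boolean.or _ _).1 hm).elim h1' h2'
      · have hl : ∀ α β : Formula, α.box ∈ u → (α.or β).box ∈ u := fun α β ha =>
          (u.box_mem_iff _).2 fun v hv => (v.boolean.or _ _).2 (.inl (hv _ ha))
        have hr : ∀ α β : Formula, β.box ∈ u → (α.or β).box ∈ u := fun α β ha =>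
          (u.box_mem_iff _).2 fun v hv => (v.boolean.or _ _).2 (.inr (hv _ ha))
        rcases h u hu with h | h | h
        · exact .inl (hl _ _ h)
        · exact .inr (.inl (hl _ _ h))
        rcases k u hu with k | k | k
        · exact .inl (hr _ _ k)
        · exact .inr (.inl (hr _ _ k))
        exact .inr (.inr (u.theory.mp h k))
  obtain ⟨u, hu, -⟩ := exists_extension hT hbot
  refine ⟨u, fun φ h => ?_, fun φ h => ?_, fun φ h => ?_⟩
  · exact hu _ ⟨_, _, t.boolean.not_bot, t'.boolean.not_bot, fun v hv => .inr (.inr (hv _ h))⟩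
  · by_contra hφ
    refine (u.boolean.neg φ.box).1 (hu _ ⟨φ, _, hφ, t'.boolean.not_bot, fun v _ => ?_⟩) h
    have := v.boolean.neg φ.box
    tauto
  · by_contra hφ
    refine (u.boolean.neg φ.box).1 (hu _ ⟨_, φ, t.boolean.not_bot, hφ, fun v _ => ?_⟩) h
    have := v.boolean.neg φ.box
    tauto

/-- The frame condition corresponding to the axiom `Cn`. -/
theorem exists_common_predecessor (s : MaxCons n) (t : Fin (n + 1) → MaxCons n)
    (ht : ∀ i, Rel s (t i)) :
    ∃ i j, i ≠ j ∧ ∃ u, Rel s u ∧ Rel u (t i) ∧ Rel u (t j) := by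
  by_contra! hno
  have hex : ∀ i j, ∃ ψ ψ', ψ ∉ t i ∧ ψ' ∉ t j ∧
      (i ≠ j → ∀ u, Rel s u → ψ.box ∈ u ∨ ψ'.box ∈ u) := by
    intro i j
    rcases exists_common_or_separated (s := s) (t := t i) (t' := t j) with
      ⟨u, h1, h2, h3⟩ | ⟨ψ, ψ', h1, h2, h3⟩
    · refine ⟨_, _, (t i).boolean.not_bot, (t j).boolean.not_bot, fun hij => ?_⟩
      exact absurd h3 (hno i j hij u h1 h2)
    · exact ⟨ψ, ψ', h1, h2, fun _ => h3⟩
  choose ψ ψ' h1 h2 h3 using hex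
  let φ : Fin (n + 1) → Formula := fun i =>
    bigOr ((List.finRange (n + 1)).map fun j => (ψ i j).or (ψ' j i))
  have hmem : ∀ i (v : MaxCons n), φ i ∈ v ↔ ∃ j, ψ i j ∈ v ∨ ψ' j i ∈ v := by
    intro i v
    refine (v.boolean.bigOr _).trans ?_
    simp only [List.mem_map, List.mem_finRange, true_and, exists_exists_eq_and]
    exact exists_congr fun j => v.boolean.or _ _
  have hφt : ∀ i, φ i ∉ t i := by
    intro i h
    obtain ⟨j, h | h⟩ := (hmem i _).1 h
    · exact h1 _ _ h
    · exact h2 _ _ h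
  have hCn := (s.boolean.imp _ _).1 (s.theory.thm (.Cn φ)) (by
    refine (s.box_mem_iff _).2 fun u hu => (u.boolean.bigAnd _).2 fun χ hχ => ?_
    obtain ⟨⟨i, j⟩, hij, rfl⟩ := List.mem_map.1 hχ
    refine (u.boolean.or _ _).2 ((h3 i j ((mem_pairs i j).1 hij).ne u hu).imp ?_ ?_)
    · exact fun h => (u.box_mem_iff _).2 fun v hv => (hmem i v).2 ⟨j, .inl (hv _ h)⟩
    · exact fun h => (u.box_mem_iff _).2 fun v hv => (hmem j v).2 ⟨i, .inr (hv _ h)⟩)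
  obtain ⟨χ, hχ, h⟩ := (s.boolean.bigOr _).1 hCn
  obtain ⟨i, -, rfl⟩ := List.mem_map.1 hχ
  exact hφt i (ht i _ h)

/-- The successors of `s` are those of at most `n` of them. -/
theorem exists_roots (s : MaxCons n) :
    ∃ r : Fin n → MaxCons n, (∀ k, Rel s (r k)) ∧ ∀ t, Rel s t → ∃ k, Rel (r k) t := by
  let S : Setoid {m // IsMinSucc s m} :=
    { r := fun a b => Rel a.1 b.1 ∧ Rel b.1 a.1
      iseqv := ⟨fun a => ⟨a.2.1.self, a.2.1.self⟩, fun h => h.symm,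
        fun h1 h2 => ⟨h1.1.trans h2.1, h2.2.trans h1.2⟩⟩ }
  obtain ⟨t₀, ht₀⟩ := s.exists_rel
  obtain ⟨m₀, hm₀, -⟩ := s.exists_isMinSucc ht₀
  have : Nonempty (Quotient S) := ⟨Quotient.mk S ⟨m₀, hm₀⟩⟩
  have hcard : Cardinal.mk (Quotient S) ≤ Cardinal.mk (Fin n) := by
    by_contra! hlt
    have hle : Cardinal.mk (Fin (n + 1)) ≤ Cardinal.mk (Quotient S) := by
      rw [Cardinal.mk_fin] at hlt ⊢
      rw [Nat.cast_succ, ← Cardinal.succ_natCast]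
      exact Order.succ_le_of_lt hlt
    obtain ⟨e⟩ := Cardinal.le_def _ _ |>.1 hle
    obtain ⟨i, j, hij, u, hsu, hi, hj⟩ := s.exists_common_predecessor
      (fun i => (e i).out.1) (fun i => (e i).out.2.1)
    refine hij (e.injective ?_)
    rw [← Quotient.out_equiv_out]
    exact ⟨((e i).out.2.2 u hsu hi).trans hj, ((e j).out.2.2 u hsu hj).trans hi⟩
  obtain ⟨e⟩ := Cardinal.le_def _ _ |>.1 hcard
  refine ⟨fun k => (Function.invFun e k).out.1, fun k => (Function.invFun e k).out.2.1,
    fun t ht => ?_⟩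
  obtain ⟨m, hm, hmt⟩ := s.exists_isMinSucc ht
  refine ⟨e (Quotient.mk S ⟨m, hm⟩), ?_⟩
  dsimp only
  rw [Function.leftInverse_invFun e.injective]
  exact (Quotient.mk_out (s := S) ⟨m, hm⟩).1.trans hmt

/-- A coloured copy of a reflexive canonical world, together with one of its successors. -/
structure Copy (n : ℕ) where
  color : Bool
  world : MaxCons n
  next : MaxCons n
  refl : Rel world world
  rel : Rel world next

/-- Mutual accessibility. -/
def Equi (s t : MaxCons n) : Prop := Rel s t ∧ Rel t s

/-- Agent `0` gets one colour and all other agents get the other. -/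
def agentColor (i : Fin n) : Bool := decide (i.val = 0)

/-- The cluster which agent `i` considers possible: at the root it is the `i`-th minimal cluster,
at a copy of the agent's own colour it is the current one, at other copies the chosen successor. -/
def target (r : Fin n → MaxCons n) (i : Fin n) : Option (Copy n) → MaxCons n
  | none => r i
  | some x => if x.color = agentColor i then x.world else x.next

/-- The canonical world represented by a state of the model. -/
def base (s : MaxCons n) : Option (Copy n) → MaxCons n
  | none => s
  | some x => x.world

/-- The KD45 model generated by a root `s` whose successors are those of the `r k`. -/
def unfolding (s : MaxCons n) (r : Fin n → MaxCons n) : Model n where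
  W := Option (Copy n)
  nonempty := ⟨none⟩
  R i x y := ∃ z, y = some z ∧ z.color = agentColor i ∧ Equi (target r i x) z.world
  V p x := Formula.atom p ∈ base s x

section Unfolding

variable {s : MaxCons n} {r : Fin n → MaxCons n}

theorem target_self (hr : ∀ k, Rel s (r k)) (i : Fin n) (x : Option (Copy n)) :
    Rel (target r i x) (target r i x) := by
  cases x with
  | none => exact (hr i).self
  | some x =>
    simp only [target]
    split_ifs
    · exact x.refl
    · exact x.rel.self

theorem rel_target (hr : ∀ k, Rel s (r k)) (i : Fin n) (x : Option (Copy n)) :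
    Rel (base s x) (target r i x) := by
  cases x with
  | none => exact hr i
  | some x =>
    simp only [target]
    split_ifs
    · exact x.refl
    · exact x.rel

theorem kd45_unfolding (hr : ∀ k, Rel s (r k)) : KD45 (unfolding s r) := by
  refine fun i => ⟨fun x => ?_, ?_, ?_⟩
  · have h := target_self hr i x
    exact ⟨some ⟨agentColor i, _, _, h, h⟩, _, rfl, rfl, h, h⟩
  · rintro x _ _ ⟨y, rfl, hy, h1⟩ ⟨z, rfl, hz, h2⟩
    simp only [target, hy, if_true] at h2
    exact ⟨z, rfl, hz, h1.1.trans h2.1, h2.2.trans h1.2⟩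
  · rintro x _ _ ⟨y, rfl, hy, h1⟩ ⟨z, rfl, hz, h2⟩
    refine ⟨z, rfl, hz, ?_⟩
    simp only [target, hy, if_true]
    exact ⟨h1.2.trans h2.1, h2.2.trans h1.1⟩

theorem rel_of_star (hr : ∀ k, Rel s (r k)) {x y : Option (Copy n)}
    (h : (unfolding s r).star x y) : Rel (base s x) (base s y) := by
  have step : ∀ {x y : Option (Copy n)}, (∃ i, (unfolding s r).R i x y) →
      Rel (base s x) (base s y) := by
    rintro x _ ⟨i, z, rfl, -, h⟩
    exact (rel_target hr i x).trans h.1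
  induction h with
  | single h => exact step h
  | tail _ h ih => exact ih.trans (step h)

theorem exists_agentColor (hn : 2 ≤ n) (c : Bool) : ∃ i : Fin n, agentColor i = c := by
  cases c
  · exact ⟨⟨1, hn⟩, rfl⟩
  · exact ⟨⟨0, by omega⟩, rfl⟩

theorem exists_star_of_rel_target (hn : 2 ≤ n) (hr : ∀ k, Rel s (r k)) (i : Fin n)
    {x : Option (Copy n)} {w : MaxCons n} (h : Rel (target r i x) w) :
    ∃ y, (unfolding s r).star x y ∧ base s y = w := by
  have hx := target_self hr i x
  obtain ⟨j, hj⟩ := exists_agentColor hn (!agentColor i)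
  refine ⟨some ⟨agentColor j, w, w, h.self, h.self⟩, .tail
    (.single ⟨i, ⟨agentColor i, target r i x, w, hx, h⟩, rfl, rfl, hx, hx⟩)
    ⟨j, _, rfl, rfl, ?_⟩, rfl⟩
  simp only [target, hj]
  simpa [Equi] using h.self

theorem exists_star (hn : 2 ≤ n) (hr : ∀ k, Rel s (r k)) (hc : ∀ t, Rel s t → ∃ k, Rel (r k) t)
    {x : Option (Copy n)} {w : MaxCons n} (h : Rel (base s x) w) :
    ∃ y, (unfolding s r).star x y ∧ base s y = w := by
  cases x with
  | none =>
    obtain ⟨k, hk⟩ := hc w h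
    exact exists_star_of_rel_target hn hr k hk
  | some x =>
    obtain ⟨i, hi⟩ := exists_agentColor hn x.color
    refine exists_star_of_rel_target hn hr i ?_
    simpa [target, base, hi] using h

theorem sat_unfolding_iff (hn : 2 ≤ n) (hr : ∀ k, Rel s (r k))
    (hc : ∀ t, Rel s t → ∃ k, Rel (r k) t) (φ : Formula) (x : Option (Copy n)) :
    Sat (unfolding s r) x φ ↔ φ ∈ base s x := by
  induction φ generalizing x with
  | atom p => exact Iff.rfl
  | neg φ ih => exact (not_congr (ih x)).trans ((base s x).boolean.neg φ).symm
  | and φ ψ ih1 ih2 => exact (and_congr (ih1 x) (ih2 x)).trans ((base s x).boolean.and φ ψ).symm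
  | box φ ih =>
    rw [box_mem_iff]
    constructor
    · intro h t ht
      obtain ⟨y, hy, rfl⟩ := exists_star hn hr hc ht
      exact (ih y).1 (h y hy)
    · exact fun h y hy => (ih y).2 (h _ (rel_of_star hr hy))

end Unfolding

end MaxCons

/-- Soundness and completeness of `CB_n` (`n ≥ 2`) with respect to the class of all
KD45 models for `n` agents. -/
theorem CB_sound_complete :
    ∀ n : ℕ, 2 ≤ n → ∀ φ : Formula,
      CB n φ ↔ (∀ M : Model n, KD45 M → ∀ s : M.W, Sat M s φ) := by
  refine fun n hn φ => ⟨fun h M hM s => h.sound (by omega) hM s, fun h => ?_⟩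
  by_contra hφ
  obtain ⟨s, -, hs⟩ := MaxCons.exists_extension (T := {φ | CB n φ}) ⟨id, .mp⟩ hφ
  obtain ⟨r, hr, hc⟩ := s.exists_roots
  exact hs ((MaxCons.sat_unfolding_iff hn hr hc φ none).1 (h _ (MaxCons.kd45_unfolding hr) none))
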